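/- Let C be a plane external to the Klein quadric, and let E be a 3-dimensional subspace of ⋀²V such that the set R of lines M of P(V) with γM ≤ E has the properties that the Plücker points γM of the members of R together span E and that any two members of R are C-parallel (i.e., R is a regulus of mutually C-parallel lines). Then any two lines N₁, N₂ of P(V) with γN₁ ≤ E^⊥ and γN₂ ≤ E^⊥ satisfy C^⊥ + γN₁ = C^⊥ + γN₂; that is, the lines of the opposite regulus are mutually C^⊥-parallel. -/

import Mathlib

open ExteriorAlgebra

variable (F : Type*) [Field F] (V : Type*) [AddCommGroup V] [Module F V]

/-- An element of the second exterior power `⋀²V` is decomposable if it is the wedge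
`u ∧ v` of two vectors of `V`. -/
def IsDecomposable (x : ⋀[F]^2 V) : Prop :=
  ∃ u v : V, (x : ExteriorAlgebra F V) = ι F u * ι F v

/-- A plane external to the Klein quadric: a 3-dimensional subspace of `⋀²V` containing
no nonzero decomposable element. -/
def IsExternalPlane (C : Submodule F ↥(⋀[F]^2 V)) : Prop :=
  Module.finrank F C = 3 ∧ ∀ x ∈ C, x ≠ 0 → ¬ IsDecomposable F V x

/-- The Plücker point `γM` of a line `M` of `P(V)`: the subspace of `⋀²V` spanned by all
wedges `u ∧ v` with `u, v ∈ M`.  For a 2-dimensional `M` this is the 1-dimensional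
subspace spanned by `u ∧ v`, where `{u, v}` is any basis of `M`. -/
def plueckerPoint (M : Submodule F V) : Submodule F ↥(⋀[F]^2 V) :=
  Submodule.span F {x : ⋀[F]^2 V | ∃ u ∈ M, ∃ v ∈ M, (x : ExteriorAlgebra F V) = ι F u * ι F v}

/-- The polar `X^⊥` of a subspace `X` of `⋀²V` with respect to the Klein quadric:
all `y` with `x ∧ y = 0` for every `x ∈ X`, the wedge being computed in the
exterior algebra of `V` (it lands in the 1-dimensional space `⋀⁴V`). -/
def polarSubspace (X : Submodule F ↥(⋀[F]^2 V)) : Submodule F ↥(⋀[F]^2 V) where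
  carrier := {y | ∀ x ∈ X, (x : ExteriorAlgebra F V) * (y : ExteriorAlgebra F V) = 0}
  add_mem' := by
    intro a b ha hb x hx
    rw [Submodule.coe_add, mul_add, ha x hx, hb x hx, add_zero]
  zero_mem' := by
    intro x hx
    simp
  smul_mem' := by
    intro c a ha x hx
    rw [Submodule.coe_smul, Algebra.mul_smul_comm, ha x hx, smul_zero]

open Module Set.powersetCard

section WedgeForm

variable {F V}

/-- The wedge pairing on `⋀²V`, read off as the coordinate of the product along the top
exterior basis vector attached to a basis `b` of `V`. -/
noncomputable def wedgeForm {I : Type*} [LinearOrder I] [Fintype I] (b : Basis I F V) :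
    LinearMap.BilinForm F (⋀[F]^2 V) :=
  ((LinearMap.mul F (ExteriorAlgebra F V)).compl₁₂
    (⋀[F]^2 V).subtype (⋀[F]^2 V).subtype).compr₂ (b.ExteriorAlgebra.coord Finset.univ)

lemma wedgeForm_apply {I : Type*} [LinearOrder I] [Fintype I] (b : Basis I F V)
    (x y : ⋀[F]^2 V) :
    wedgeForm b x y =
      b.ExteriorAlgebra.repr ((x : ExteriorAlgebra F V) * (y : ExteriorAlgebra F V))
        Finset.univ :=
  rfl

lemma wedgeForm_basis_of_ne (b : Basis (Fin 4) F V) (s t : Set.powersetCard (Fin 4) 2)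
    (h : ¬ Disjoint s.val t.val) :
    wedgeForm b (b.exteriorPower 2 s) (b.exteriorPower 2 t) = 0 := by
  rw [wedgeForm_apply, ← basis_eq_coe_basis, ← basis_eq_coe_basis,
    basis_mul_of_not_disjoint b s t h]
  simp

lemma wedgeForm_basis_of_disjoint (b : Basis (Fin 4) F V) (s t : Set.powersetCard (Fin 4) 2)
    (h : Disjoint s.val t.val) :
    wedgeForm b (b.exteriorPower 2 s) (b.exteriorPower 2 t) ≠ 0 := by
  have huniv : ((disjUnion h : Set.powersetCard (Fin 4) (2 + 2)) : Finset (Fin 4)) =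
      Finset.univ := by
    apply Finset.eq_univ_of_card
    simpa using (disjUnion h).2
  rw [wedgeForm_apply, ← basis_eq_coe_basis, ← basis_eq_coe_basis,
    basis_mul_of_disjoint b s t h, huniv]
  rcases Int.units_eq_one_or (permOfDisjoint h).sign with h1 | h1 <;> simp [h1]

lemma disjoint_iff_eq_compl (s t : Set.powersetCard (Fin 4) 2) :
    Disjoint s.val t.val ↔ t = compl (m := 2) (n := 2) (by simp) s := by
  rw [Subtype.ext_iff]
  change _ ↔ t.val = (s.val)ᶜ
  constructor
  · intro h
    apply Finset.eq_of_subset_of_card_le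
    · exact Finset.subset_compl_iff_disjoint_left.mpr h
    · have hs : s.val.card = 2 := s.2
      have ht : t.val.card = 2 := t.2
      rw [Finset.card_compl, hs, ht]
      simp
  · intro h
    rw [h]
    exact disjoint_compl_right

lemma wedgeForm_nondegenerate (b : Basis (Fin 4) F V) : (wedgeForm b).Nondegenerate := by
  constructor
  · intro x hx
    apply (b.exteriorPower 2).ext_elem
    intro s
    obtain ⟨t, ht⟩ : ∃ t : Set.powersetCard (Fin 4) 2, Disjoint s.val t.val :=
      ⟨_, (disjoint_iff_eq_compl s _).mpr rfl⟩
    have key := hx (b.exteriorPower 2 t)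
    rw [← (b.exteriorPower 2).sum_repr x, map_sum, LinearMap.sum_apply,
      Finset.sum_eq_single s] at key
    · rw [map_smul, LinearMap.smul_apply, smul_eq_mul] at key
      simpa using (mul_eq_zero.mp key).resolve_right (wedgeForm_basis_of_disjoint b s t ht)
    · intro s' _ hs'
      rw [map_smul, LinearMap.smul_apply, wedgeForm_basis_of_ne, smul_zero]
      intro h
      rw [disjoint_comm, disjoint_iff_eq_compl] at h ht
      exact hs' (h.trans ht.symm)
    · simp
  · intro x hx
    apply (b.exteriorPower 2).ext_elem
    intro s
    obtain ⟨t, ht⟩ : ∃ t : Set.powersetCard (Fin 4) 2, Disjoint s.val t.val :=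
      ⟨_, (disjoint_iff_eq_compl s _).mpr rfl⟩
    have key := hx (b.exteriorPower 2 t)
    rw [← (b.exteriorPower 2).sum_repr x, map_sum, Finset.sum_eq_single s] at key
    · rw [map_smul, smul_eq_mul] at key
      simpa using (mul_eq_zero.mp key).resolve_right (wedgeForm_basis_of_disjoint b t s ht.symm)
    · intro s' _ hs'
      rw [map_smul, wedgeForm_basis_of_ne, smul_zero]
      intro h
      rw [disjoint_comm] at ht
      rw [disjoint_iff_eq_compl] at h ht
      exact hs' (h.trans ht.symm)
    · simp

lemma wedgeForm_eq_zero_iff (b : Basis (Fin 4) F V) (x y : ⋀[F]^2 V) :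
    wedgeForm b x y = 0 ↔ (x : ExteriorAlgebra F V) * (y : ExteriorAlgebra F V) = 0 := by
  rw [wedgeForm_apply]
  refine ⟨fun h => ?_, fun h => by simp [h]⟩
  have hmem : (x : ExteriorAlgebra F V) * (y : ExteriorAlgebra F V) ∈ ⋀[F]^4 V := by
    change _ ∈ LinearMap.range (ι F : V →ₗ[F] ExteriorAlgebra F V) ^ (2 + 2)
    rw [pow_add]
    exact Submodule.mul_mem_mul x.2 y.2
  obtain ⟨z, hz⟩ : ∃ z : ⋀[F]^4 V,
      (z : ExteriorAlgebra F V) = (x : ExteriorAlgebra F V) * (y : ExteriorAlgebra F V) :=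
    ⟨⟨_, hmem⟩, rfl⟩
  rw [← hz] at h ⊢
  let s₀ : Set.powersetCard (Fin 4) 4 := ⟨Finset.univ, by simp [Set.powersetCard.mem_iff]⟩
  have hs : ∀ s : Set.powersetCard (Fin 4) 4, s = s₀ := fun s =>
    Subtype.ext (Finset.eq_univ_of_card _ (by simp))
  have hzs : z = (b.exteriorPower 4).repr z s₀ • b.exteriorPower 4 s₀ := by
    conv_lhs => rw [← (b.exteriorPower 4).sum_repr z]
    exact Finset.sum_eq_single s₀ (fun s _ hne => absurd (hs s) hne) (by simp)
  rw [hzs, Submodule.coe_smul, ← basis_eq_coe_basis] at h ⊢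
  have h0 : (b.exteriorPower 4).repr z s₀ = 0 := by simpa [s₀] using h
  rw [h0, zero_smul]

lemma polarSubspace_eq_orthogonal (b : Basis (Fin 4) F V) (X : Submodule F (⋀[F]^2 V)) :
    polarSubspace F V X = (wedgeForm b).orthogonal X := by
  ext y
  exact forall₂_congr fun x _ => (wedgeForm_eq_zero_iff b x y).symm

end WedgeForm

section Polar

variable {F V} [FiniteDimensional F V]

lemma finrank_polarSubspace_add (hV : finrank F V = 4) (X : Submodule F (⋀[F]^2 V)) :
    finrank F (polarSubspace F V X) + finrank F X = 6 := by
  let b := finBasisOfFinrankEq F V hV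
  have h6 : finrank F (⋀[F]^2 V) = 6 := by
    rw [exteriorPower.finrank_eq, hV]
    rfl
  have hX := Submodule.finrank_le X
  rw [polarSubspace_eq_orthogonal b,
    LinearMap.BilinForm.finrank_orthogonal (wedgeForm_nondegenerate b)]
  lia

end Polar

variable {F V} in
lemma polarSubspace_anti {X Y : Submodule F (⋀[F]^2 V)} (h : X ≤ Y) :
    polarSubspace F V Y ≤ polarSubspace F V X :=
  fun _ hy x hx => hy x (h hx)

section Decomposable

variable {V}

/-- Wedging with a fixed vector, as a linear map `V → ⋀²V`. -/
noncomputable def wedgeLeft (u : V) : V →ₗ[F] ⋀[F]^2 V :=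
  ((LinearMap.mulLeft F (ι F u)).comp (ι F)).codRestrict (⋀[F]^2 V) fun v => by
    change _ ∈ LinearMap.range (ι F : V →ₗ[F] ExteriorAlgebra F V) ^ 2
    rw [pow_two]
    exact Submodule.mul_mem_mul (LinearMap.mem_range_self _ u) (LinearMap.mem_range_self _ v)

@[simp]
lemma coe_wedgeLeft (u v : V) :
    (wedgeLeft F u v : ExteriorAlgebra F V) = ι F u * ι F v :=
  rfl

variable {F}

lemma isDecomposable_wedgeLeft (u v : V) : IsDecomposable F V (wedgeLeft F u v) :=
  ⟨u, v, rfl⟩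

lemma wedgeLeft_ne_zero {u v : V} (h : LinearIndependent F ![u, v]) :
    wedgeLeft F u v ≠ 0 := by
  have hfam := exteriorPower.ιMulti_family_linearIndependent_field (n := 2) h
  let s : Set.powersetCard (Fin 2) 2 := ofFinEmbEquiv (RelEmbedding.refl _)
  have hne := hfam.ne_zero s
  intro h0
  apply hne
  apply Subtype.ext
  rw [exteriorPower.ιMulti_family_apply_coe, ιMulti_family, Equiv.symm_apply_apply]
  simpa [ιMulti_apply] using (coe_wedgeLeft F u v).symm.trans (congrArg Subtype.val h0)

lemma ι_mul_swap (u v : V) : ι F u * ι F v = -(ι F v * ι F u) :=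
  eq_neg_of_add_eq_zero_left (ι_add_mul_swap u v)

lemma wedgeLeft_mul_wedgeLeft (u v w : V) :
    (wedgeLeft F u w : ExteriorAlgebra F V) * (wedgeLeft F u v : ExteriorAlgebra F V) = 0 := by
  rw [coe_wedgeLeft, coe_wedgeLeft, ι_mul_swap u w, neg_mul, mul_assoc, ← mul_assoc (ι F u),
    ι_sq_zero, zero_mul, mul_zero, neg_zero]

lemma finrank_range_wedgeLeft [FiniteDimensional F V] {u : V} (hu : u ≠ 0) :
    finrank F V ≤ finrank F (LinearMap.range (wedgeLeft F u)) + 1 := by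
  have hker : LinearMap.ker (wedgeLeft F u) ≤ Submodule.span F {u} := by
    intro v hv
    by_contra hmem
    refine wedgeLeft_ne_zero ((LinearIndependent.pair_iff' hu).mpr fun a ha => hmem ?_) hv
    exact Submodule.mem_span_singleton.mpr ⟨a, ha⟩
  have h1 := Submodule.finrank_mono hker
  rw [finrank_span_singleton hu] at h1
  have h2 := LinearMap.finrank_range_add_finrank_ker (wedgeLeft F u)
  lia

lemma exists_plueckerPoint_eq_span (M : Submodule F V) (hM : finrank F M = 2) :
    ∃ u v : V, wedgeLeft F u v ≠ 0 ∧
      plueckerPoint F V M = Submodule.span F {wedgeLeft F u v} := by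
  have : FiniteDimensional F M := Module.finite_of_finrank_eq_succ hM
  let b := finBasisOfFinrankEq F M hM
  refine ⟨b 0, b 1, wedgeLeft_ne_zero ?_, le_antisymm ?_ ?_⟩
  · have h := b.linearIndependent.map' M.subtype M.ker_subtype
    have hcomp : M.subtype ∘ b = ![(b 0 : V), (b 1 : V)] := by
      ext i
      fin_cases i <;> rfl
    rwa [hcomp] at h
  · refine Submodule.span_le.mpr ?_
    rintro x ⟨p, hp, q, hq, hx⟩
    have hexp : ∀ p (hp : p ∈ M), ∃ c d : F, p = c • (b 0 : V) + d • (b 1 : V) := by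
      intro p hp
      refine ⟨b.repr ⟨p, hp⟩ 0, b.repr ⟨p, hp⟩ 1, ?_⟩
      have h := congrArg Subtype.val (b.sum_repr ⟨p, hp⟩)
      rw [Fin.sum_univ_two] at h
      exact h.symm
    obtain ⟨c, d, rfl⟩ := hexp p hp
    obtain ⟨c', d', rfl⟩ := hexp q hq
    refine Submodule.mem_span_singleton.mpr ⟨c * d' - d * c', Subtype.ext ?_⟩
    rw [hx, Submodule.coe_smul, coe_wedgeLeft]
    simp only [map_add, map_smul, add_mul, mul_add, smul_mul_assoc, mul_smul_comm, ι_sq_zero,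
      smul_zero, ι_mul_swap (b 1 : V) (b 0 : V)]
    module
  · exact Submodule.span_mono (Set.singleton_subset_iff.mpr ⟨b 0, (b 0).2, b 1, (b 1).2, rfl⟩)

/-- The polar of an external plane contains no nonzero decomposable element. -/
lemma wedgeLeft_notMem_polarSubspace [FiniteDimensional F V] (hV : finrank F V = 4)
    {C : Submodule F (⋀[F]^2 V)} (hC : IsExternalPlane F V C) {u v : V}
    (huv : wedgeLeft F u v ≠ 0) : wedgeLeft F u v ∉ polarSubspace F V C := by
  intro hmem
  have hu : u ≠ 0 := by
    rintro rfl
    exact huv (Subtype.ext (by simp))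
  let b := finBasisOfFinrankEq F V hV
  let H : Submodule F (⋀[F]^2 V) := LinearMap.ker ((wedgeForm b).flip (wedgeLeft F u v))
  have hmemH : ∀ x : ⋀[F]^2 V, x ∈ H ↔
      (x : ExteriorAlgebra F V) * (wedgeLeft F u v : ExteriorAlgebra F V) = 0 := fun x =>
    wedgeForm_eq_zero_iff b x _
  have hH : H ≠ ⊤ := by
    intro htop
    apply huv
    refine (wedgeForm_nondegenerate b).2 _ fun x => ?_
    exact LinearMap.mem_ker.mp (htop ▸ Submodule.mem_top : x ∈ H)
  have hHrank := Submodule.finrank_lt hH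
  have h6 : finrank F (⋀[F]^2 V) = 6 := by
    rw [exteriorPower.finrank_eq, hV]
    rfl
  have hCH : C ≤ H := fun x hx => (hmemH x).mpr (hmem x hx)
  have hTH : LinearMap.range (wedgeLeft F u) ≤ H := by
    rintro _ ⟨w, rfl⟩
    exact (hmemH _).mpr (wedgeLeft_mul_wedgeLeft u v w)
  have hsup := Submodule.finrank_mono (sup_le hCH hTH)
  have hsum := Submodule.finrank_sup_add_finrank_inf_eq C (LinearMap.range (wedgeLeft F u))
  have hT := finrank_range_wedgeLeft (F := F) hu
  have hbot : C ⊓ LinearMap.range (wedgeLeft F u) = ⊥ := by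
    rw [eq_bot_iff]
    rintro x ⟨hxC, w, rfl⟩
    by_contra hx
    exact hC.2 _ hxC hx (isDecomposable_wedgeLeft u w)
  rw [hbot, finrank_bot, hC.1] at hsum
  lia

end Decomposable

/-- If the lines of a regulus (cut out on the Klein quadric by a plane `E`) are mutually
`C`-parallel, then the lines of the opposite regulus (cut out by `E^⊥`) are mutually
`C^⊥`-parallel. -/
theorem opposite_regulus_is_polar_parallel
    [FiniteDimensional F V] (hV : Module.finrank F V = 4)
    (C : Submodule F ↥(⋀[F]^2 V)) (hC : IsExternalPlane F V C)
    (E : Submodule F ↥(⋀[F]^2 V)) (hE : Module.finrank F E = 3)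
    (hspan :
      (⨆ M ∈ {M : Submodule F V | Module.finrank F M = 2 ∧ plueckerPoint F V M ≤ E},
        plueckerPoint F V M) = E)
    (hpar : ∀ M N : Submodule F V,
      (Module.finrank F M = 2 ∧ plueckerPoint F V M ≤ E) →
      (Module.finrank F N = 2 ∧ plueckerPoint F V N ≤ E) →
        C ⊔ plueckerPoint F V M = C ⊔ plueckerPoint F V N) :
    ∀ N₁ N₂ : Submodule F V, Module.finrank F N₁ = 2 → Module.finrank F N₂ = 2 →
      plueckerPoint F V N₁ ≤ polarSubspace F V E →
      plueckerPoint F V N₂ ≤ polarSubspace F V E →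
        polarSubspace F V C ⊔ plueckerPoint F V N₁ =
          polarSubspace F V C ⊔ plueckerPoint F V N₂ := by
  have hCE : 2 ≤ finrank F ↥(C ⊓ E) := by
    obtain ⟨M₀, hM₀⟩ : ∃ M : Submodule F V, finrank F M = 2 ∧ plueckerPoint F V M ≤ E := by
      by_contra! hne
      have hbot : E = ⊥ := by
        rw [← hspan, eq_bot_iff]
        exact iSup₂_le fun M hM => absurd hM.2 (hne M hM.1)
      rw [hbot, finrank_bot] at hE
      lia
    have hle : C ⊔ E ≤ C ⊔ plueckerPoint F V M₀ := by
      refine sup_le le_sup_left ?_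
      conv_lhs => rw [← hspan]
      exact iSup₂_le fun M hM => (hpar M M₀ hM hM₀) ▸ le_sup_right
    have h1 := Submodule.finrank_mono hle
    obtain ⟨u, v, huv, hM⟩ := exists_plueckerPoint_eq_span M₀ hM₀.1
    have h2 := Submodule.finrank_add_le_finrank_add_finrank C (plueckerPoint F V M₀)
    have h3 := Submodule.finrank_sup_add_finrank_inf_eq C E
    have h4 : finrank F (plueckerPoint F V M₀) = 1 := by rw [hM, finrank_span_singleton huv]
    have h5 := hC.1
    lia
  have hCperp := finrank_polarSubspace_add hV C
  have hCEperp := finrank_polarSubspace_add hV (C ⊓ E)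
  have key : ∀ N : Submodule F V, finrank F N = 2 → plueckerPoint F V N ≤ polarSubspace F V E →
      polarSubspace F V C ⊔ plueckerPoint F V N = polarSubspace F V (C ⊓ E) := by
    intro N hN hNE
    apply Submodule.eq_of_le_of_finrank_le
    · exact sup_le (polarSubspace_anti inf_le_left) (hNE.trans (polarSubspace_anti inf_le_right))
    · obtain ⟨u, v, huv, hspanN⟩ := exists_plueckerPoint_eq_span N hN
      rw [hspanN, Submodule.finrank_sup_span_singleton (wedgeLeft_notMem_polarSubspace hV hC huv)]
      have := hC.1
      lia
  intro N₁ N₂ h₁ h₂ hN₁ hN₂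
  rw [key N₁ h₁ hN₁, key N₂ h₂ hN₂]
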